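/- arXiv:math/9908141 — 4 statements merged into one kernel-verified Lean document; each statement's English description precedes it below -/
import Mathlib

section
/- If α is a nonnegative integer, then the polynomials a_i(α,x) satisfy: deg a_i = i for 1 ≤ i ≤ α+2; deg a_i = α+2 for α+3 ≤ i ≤ 2α+4; and a_i(α,x) = 0 identically for all i ≥ 2α+5. -/
open Finset

/-- Generalized binomial coefficient `C(z, k)` for real `z` and integer `k`,
equal to `z (z-1) ⋯ (z-k+1) / k!` for `k ≥ 0` and `0` for `k < 0`. -/
noncomputable def gbinom (z : ℝ) (k : ℤ) : ℝ :=
  if 0 ≤ k then (∏ j ∈ Finset.range k.toNat, (z - (j : ℝ))) / (Nat.factorial k.toNat : ℝ)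
  else 0

/-- Pochhammer symbol `(z)_k = z (z+1) ⋯ (z+k-1)`. -/
noncomputable def poch (z : ℝ) (k : ℕ) : ℝ :=
  ∏ j ∈ Finset.range k, (z + (j : ℝ))

/-- Classical Laguerre polynomial `L_n^α(x) = ∑_{k=0}^n (-1)^k C(n+α, n-k) x^k / k!`. -/
noncomputable def laguerre (α : ℝ) (n : ℕ) (x : ℝ) : ℝ :=
  ∑ k ∈ Finset.range (n + 1),
    (-1 : ℝ) ^ k * gbinom ((n : ℝ) + α) ((n : ℤ) - (k : ℤ)) * x ^ k / (Nat.factorial k : ℝ)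

/-- The coefficient functions `a_i(α, x)` for `i ≥ 1`. -/
noncomputable def aFun (α : ℝ) (i : ℕ) (x : ℝ) : ℝ :=
  (1 / (Nat.factorial i : ℝ)) * ∑ j ∈ Finset.Icc 1 i,
    (-1 : ℝ) ^ (i + j + 1) * gbinom (α + 1) ((j : ℤ) - 1) *
      gbinom (α + 2) ((i : ℤ) - (j : ℤ)) * poch (α + 3) (i - j) * x ^ j

/-- The coefficient `a_i(α, ·)` as a polynomial in `x`. -/
noncomputable def aPoly (α : ℝ) (i : ℕ) : Polynomial ℝ :=
  Polynomial.C (1 / (Nat.factorial i : ℝ)) * ∑ j ∈ Finset.Icc 1 i,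
    Polynomial.C ((-1 : ℝ) ^ (i + j + 1) * gbinom (α + 1) ((j : ℤ) - 1) *
      gbinom (α + 2) ((i : ℤ) - (j : ℤ)) * poch (α + 3) (i - j)) * Polynomial.X ^ j

theorem gbinom_natCast_eq_zero_iff (n k : ℕ) : gbinom (n : ℝ) (k : ℤ) = 0 ↔ n < k := by
  have hk : (Nat.factorial k : ℝ) ≠ 0 := by positivity
  simp only [gbinom, Int.natCast_nonneg, if_true, Int.toNat_natCast, div_eq_zero_iff, hk,
    or_false, Finset.prod_eq_zero_iff, Finset.mem_range, sub_eq_zero, Nat.cast_inj]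
  exact ⟨fun ⟨j, hj, h⟩ => h ▸ hj, fun h => ⟨n, h, rfl⟩⟩

theorem poch_pos {z : ℝ} (hz : 0 < z) (k : ℕ) : 0 < poch z k :=
  Finset.prod_pos fun j _ => by positivity

theorem coeff_aPoly (α : ℝ) (i m : ℕ) :
    (aPoly α i).coeff m = if m ∈ Finset.Icc 1 i then
      (1 / (Nat.factorial i : ℝ)) * ((-1 : ℝ) ^ (i + m + 1) * gbinom (α + 1) ((m : ℤ) - 1) *
        gbinom (α + 2) ((i : ℤ) - (m : ℤ)) * poch (α + 3) (i - m)) else 0 := by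
  simp only [aPoly, Polynomial.coeff_C_mul, Polynomial.finsetSum_coeff, Polynomial.coeff_X_pow,
    mul_ite, mul_one, mul_zero, Finset.sum_ite_eq]

theorem coeff_aPoly_natCast_ne_zero_iff (α i m : ℕ) :
    (aPoly (α : ℝ) i).coeff m ≠ 0 ↔ 1 ≤ m ∧ m ≤ i ∧ m ≤ α + 2 ∧ i ≤ m + (α + 2) := by
  rw [coeff_aPoly]
  split_ifs with h
  · obtain ⟨h₁, h₂⟩ := Finset.mem_Icc.mp h
    have hi : (Nat.factorial i : ℝ) ≠ 0 := by positivity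
    have hp : poch ((α : ℝ) + 3) (i - m) ≠ 0 := (poch_pos (by positivity) _).ne'
    have hb₁ := gbinom_natCast_eq_zero_iff (α + 1) (m - 1)
    have hb₂ := gbinom_natCast_eq_zero_iff (α + 2) (i - m)
    push_cast [Nat.cast_sub h₁, Nat.cast_sub h₂] at hb₁ hb₂
    simp only [ne_eq, mul_eq_zero, one_div, inv_eq_zero, hi, hp, hb₁, hb₂, pow_eq_zero_iff',
      neg_eq_zero, one_ne_zero, false_and, false_or, or_false]
    omega
  · rw [Finset.mem_Icc] at h
    simp only [ne_eq, not_true_eq_false, false_iff]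
    omega

theorem degree_aPoly_natCast {α i d : ℕ} (hd : 1 ≤ d) (hmin : d = min i (α + 2))
    (hi : i ≤ 2 * α + 4) : (aPoly (α : ℝ) i).degree = d := by
  refine Polynomial.degree_eq_of_le_of_coeff_ne_zero ?_ ?_
  · rw [Polynomial.degree_le_iff_coeff_zero]
    intro m hm
    have hm' : d < m := by exact_mod_cast hm
    by_contra h
    have := (coeff_aPoly_natCast_ne_zero_iff α i m).mp h
    omega
  · rw [coeff_aPoly_natCast_ne_zero_iff]
    omega

/-- For a nonnegative integer `α`: `deg a_i = i` for `1 ≤ i ≤ α+2`,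
`deg a_i = α+2` for `α+3 ≤ i ≤ 2α+4`, and `a_i = 0` for `i ≥ 2α+5`. -/
theorem statement2 (α : ℕ) :
    (∀ i : ℕ, 1 ≤ i → i ≤ α + 2 → (aPoly (α : ℝ) i).degree = (i : ℕ)) ∧
    (∀ i : ℕ, α + 3 ≤ i → i ≤ 2 * α + 4 → (aPoly (α : ℝ) i).degree = ((α + 2 : ℕ) : ℕ)) ∧
    (∀ i : ℕ, 2 * α + 5 ≤ i → aPoly (α : ℝ) i = 0) := by
  refine ⟨fun i h₁ h₂ => degree_aPoly_natCast h₁ (by omega) (by omega),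
    fun i h₁ h₂ => degree_aPoly_natCast (by omega) (by omega) h₂, fun i hi => ?_⟩
  ext m
  rw [Polynomial.coeff_zero]
  by_contra h
  have := (coeff_aPoly_natCast_ne_zero_iff α i m).mp h
  omega
end

section
/- If α is a nonnegative integer, then for every real x, Σ_{i=1}^∞ a_i(α,x) = 0. -/
open Finset

theorem gbinom_natCast (n k : ℕ) : gbinom (n : ℝ) (k : ℤ) = (n.choose k : ℝ) := by
  rw [gbinom, if_pos (Int.natCast_nonneg k), Int.toNat_natCast,
    div_eq_iff (Nat.cast_ne_zero.mpr k.factorial_ne_zero),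
    ← descPochhammer_eval_eq_prod_range, descPochhammer_eval_eq_descFactorial,
    Nat.descFactorial_eq_factorial_mul_choose, Nat.cast_mul, mul_comm]

theorem factorial_mul_poch (n m : ℕ) :
    (n.factorial : ℝ) * poch ((n : ℝ) + 1) m = ((n + m).factorial : ℝ) := by
  have h : poch ((n : ℝ) + 1) m = ((n + 1).ascFactorial m : ℝ) := by
    simp [poch, Nat.ascFactorial_eq_prod_range]
  rw [h, ← Nat.cast_mul, Nat.factorial_mul_ascFactorial]

/-- The `n`-th forward difference of the polynomial
`m ↦ (n + m)! / (k + m + 1)!`, of degree `n - k - 1 < n`, vanishes. -/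
theorem sum_choose_mul_poch_div_factorial_eq_zero {n k : ℕ} (hk : k < n) :
    ∑ m ∈ range (n + 1), (-1 : ℝ) ^ m * (n.choose m : ℝ) * poch ((n : ℝ) + 1) m /
      ((k + m + 1).factorial : ℝ) = 0 := by
  have hdeg : (descPochhammer ℝ (n - (k + 1))).natDegree < n := by
    rw [descPochhammer_natDegree]; omega
  have h := congrFun (Polynomial.fwdDiff_iter_eq_zero_of_degree_lt hdeg) (n : ℝ)
  rw [fwdDiff_iter_eq_sum_shift] at h
  have hn : (n.factorial : ℝ) ≠ 0 := Nat.cast_ne_zero.mpr n.factorial_ne_zero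
  refine Eq.trans (sum_congr rfl fun m hm => ?_)
    ((mul_sum _ _ ((-1 : ℝ) ^ n / (n.factorial : ℝ))).symm.trans (by rw [h]; simp))
  have hmn : m ≤ n := Nat.lt_succ_iff.mp (mem_range.mp hm)
  have hdesc : (((k + m + 1).factorial : ℕ) : ℝ) * ((n + m).descFactorial (n - (k + 1)) : ℝ)
      = ((n + m).factorial : ℝ) := by
    have := Nat.factorial_mul_descFactorial (show n - (k + 1) ≤ n + m by omega)
    rw [show n + m - (n - (k + 1)) = k + m + 1 by omega] at this
    exact_mod_cast this
  have hk0 : ((k + m + 1).factorial : ℝ) ≠ 0 := Nat.cast_ne_zero.mpr (Nat.factorial_ne_zero _)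
  have hsign : (-1 : ℝ) ^ n * (-1) ^ (n - m) = (-1) ^ m := by
    rw [← pow_add, show n + (n - m) = m + 2 * (n - m) by omega, pow_add, pow_mul]
    simp
  have heval : (descPochhammer ℝ (n - (k + 1))).eval ((n : ℝ) + m • (1 : ℝ))
      = ((n + m).descFactorial (n - (k + 1)) : ℝ) := by
    rw [← descPochhammer_eval_eq_descFactorial]; simp
  rw [heval, zsmul_eq_mul, ← hsign, div_mul_eq_mul_div, div_eq_div_iff hk0 hn]
  push_cast
  linear_combination (-1 : ℝ) ^ n * (-1) ^ (n - m) * (n.choose m : ℝ) *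
    (factorial_mul_poch n m - hdesc)

/-- The double-indexed summand of `aFun`, with `k = j - 1` and `m = i - j`. -/
noncomputable def aTerm (α : ℕ) (x : ℝ) (p : ℕ × ℕ) : ℝ :=
  -((α + 1).choose p.1 * x ^ (p.1 + 1)) *
    ((-1 : ℝ) ^ p.2 * ((α + 2).choose p.2 : ℝ) * poch (((α + 2 : ℕ) : ℝ) + 1) p.2 /
      ((p.1 + p.2 + 1).factorial : ℝ))

theorem aFun_succ_eq_sum_antidiagonal (α : ℕ) (x : ℝ) (i : ℕ) :
    aFun (α : ℝ) (i + 1) x = ∑ p ∈ antidiagonal i, aTerm α x p := by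
  rw [Nat.sum_antidiagonal_eq_sum_range_succ_mk, aFun, ← Finset.Ico_add_one_right_eq_Icc,
    sum_Ico_eq_sum_range, mul_sum]
  refine sum_congr (by simp) fun k hk => ?_
  have hki : k ≤ i := by simp at hk; omega
  obtain ⟨m, rfl⟩ := Nat.exists_eq_add_of_le hki
  have h1 : gbinom ((α : ℝ) + 1) (((1 + k : ℕ) : ℤ) - 1) = ((α + 1).choose k : ℝ) := by
    rw [← gbinom_natCast]; congr 1 <;> push_cast <;> ring
  have h2 : gbinom ((α : ℝ) + 2) (((k + m + 1 : ℕ) : ℤ) - ((1 + k : ℕ) : ℤ))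
      = ((α + 2).choose m : ℝ) := by
    rw [← gbinom_natCast]; congr 1 <;> push_cast <;> ring
  have h3 : (α : ℝ) + 3 = ((α + 2 : ℕ) : ℝ) + 1 := by push_cast; ring
  have hsign : (-1 : ℝ) ^ (k + m + 1 + (1 + k) + 1) = -(-1) ^ m := by
    rw [show k + m + 1 + (1 + k) + 1 = m + 2 * (k + 1) + 1 by ring, pow_succ, pow_add, pow_mul]
    simp
  rw [h1, h2, h3, hsign, show k + m + 1 - (1 + k) = m by omega, aTerm,
    show k + m - k = m by omega, add_comm 1 k]
  ring

theorem summable_aTerm (α : ℕ) (x : ℝ) : Summable (aTerm α x) := by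
  refine summable_of_ne_finset_zero (s := range (α + 2) ×ˢ range (α + 3)) fun p hp => ?_
  rw [mem_product, mem_range, mem_range, not_and_or, not_lt, not_lt] at hp
  rcases hp with hp | hp
  · simp [aTerm, Nat.choose_eq_zero_of_lt (show α + 1 < p.1 by omega)]
  · simp [aTerm, Nat.choose_eq_zero_of_lt (show α + 2 < p.2 by omega)]

theorem tsum_aTerm_eq_zero (α : ℕ) (x : ℝ) (k : ℕ) : ∑' m, aTerm α x (k, m) = 0 := by
  rcases lt_or_ge k (α + 2) with hk | hk
  · rw [tsum_eq_sum (s := range (α + 2 + 1)) fun m hm => ?_]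
    · simp only [aTerm]
      rw [← mul_sum, sum_choose_mul_poch_div_factorial_eq_zero hk, mul_zero]
    · rw [mem_range, not_lt] at hm
      simp [aTerm, Nat.choose_eq_zero_of_lt (show α + 2 < m by omega)]
  · simp [aTerm, Nat.choose_eq_zero_of_lt (show α + 1 < k by omega)]

/-- For nonnegative integer `α`: `∑_{i=1}^∞ a_i(α,x) = 0`. -/
theorem statement5 (α : ℕ) (x : ℝ) :
    ∑' i : ℕ, aFun (α : ℝ) (i + 1) x = 0 := by
  have hs := summable_aTerm α x
  have hs' := HasAntidiagonal.sigmaAntidiagonalEquivProd.summable_iff.mpr hs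
  calc ∑' i : ℕ, aFun (α : ℝ) (i + 1) x
      = ∑' (i : ℕ) (p : antidiagonal i), aTerm α x p := by
        refine tsum_congr fun i => ?_
        rw [aFun_succ_eq_sum_antidiagonal, Finset.tsum_subtype (antidiagonal i) (aTerm α x)]
    _ = ∑' p, aTerm α x p := by
        rw [← HasAntidiagonal.sigmaAntidiagonalEquivProd.tsum_eq (aTerm α x)]
        exact (hs'.tsum_sigma).symm
    _ = ∑' (k : ℕ) (m : ℕ), aTerm α x (k, m) := hs.tsum_prod
    _ = 0 := by simp [tsum_aTerm_eq_zero]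
end

section
/- For every real α > −1 and all integers j > k ≥ 1, the series Σ_{i=j}^∞ ((−1)^i/(i−k)!) · C(α+2, i−j) · (α+3)_{i−j} converges and equals (−1)^j · Γ(j−k)/(Γ(j−k+α+3)·Γ(j−k−α−2)), where 1/Γ is interpreted as the entire function taking the value 0 at nonpositive integers. -/
open Finset

open Filter Topology

/-- The coefficient `(-a)_i (a+1)_i / (i!)^2`. -/
noncomputable def hyperCoeff (a : ℝ) (i : ℕ) : ℝ :=
  ∏ l ∈ Finset.range i, ((l : ℝ) - a) * ((l : ℝ) + a + 1) / ((l : ℝ) + 1) ^ 2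

/-- The `i`-th term of the hypergeometric series `₂F₁(-a, a+1; m+1; 1)`. -/
noncomputable def hyperTerm (a : ℝ) (m i : ℕ) : ℝ :=
  hyperCoeff a i / ((m + i).choose i : ℝ)

/-- The value `m! Γ(m) / (Γ(m+a+1) Γ(m-a))` of `₂F₁(-a, a+1; m+1; 1)`. -/
noncomputable def gaussValue (a : ℝ) (m : ℕ) : ℝ :=
  (m.factorial : ℝ) * (Real.Gamma m / (Real.Gamma (m + a + 1) * Real.Gamma (m - a)))

theorem hyperCoeff_succ (a : ℝ) (i : ℕ) :
    hyperCoeff a (i + 1) =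
      hyperCoeff a i * (((i : ℝ) - a) * ((i : ℝ) + a + 1) / ((i : ℝ) + 1) ^ 2) :=
  Finset.prod_range_succ _ _

theorem choose_add_succ_left (m i : ℕ) :
    ((m + 1 + i).choose i : ℝ) * (m + 1) = (m + i).choose i * (m + 1 + i) := by
  have h := Nat.add_one_mul_choose_eq (m + i) m
  rw [show (m + 1 + i).choose i = (m + i + 1).choose (m + 1) by
      rw [← Nat.choose_symm_add]; congr 1; omega,
    ← Nat.choose_symm_add]
  have h' := congrArg (Nat.cast : ℕ → ℝ) h
  push_cast at h'
  linear_combination -h'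

theorem choose_add_succ_right (m i : ℕ) :
    ((m + (i + 1)).choose (i + 1) : ℝ) * (i + 1) = (m + i).choose i * (m + 1 + i) := by
  have h' := congrArg (Nat.cast : ℕ → ℝ) (Nat.add_one_mul_choose_eq (m + i) i)
  push_cast at h'
  rw [← add_assoc]
  linear_combination -h'

theorem choose_add_pos (m i : ℕ) : (0 : ℝ) < (m + i).choose i :=
  Nat.cast_pos.2 (Nat.choose_pos (Nat.le_add_left i m))

theorem hyperTerm_succ_left (a : ℝ) (m i : ℕ) :
    hyperTerm a (m + 1) i * (m + 1 + i) = hyperTerm a m i * (m + 1) := by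
  have h := choose_add_succ_left m i
  have h1 := choose_add_pos m i
  have h2 := choose_add_pos (m + 1) i
  unfold hyperTerm
  rw [div_mul_eq_mul_div, div_mul_eq_mul_div, div_eq_div_iff h2.ne' h1.ne']
  linear_combination -hyperCoeff a i * h

theorem hyperTerm_succ_right (a : ℝ) (m i : ℕ) :
    (i + 1) * hyperTerm a m (i + 1) * (m + 1 + i) =
      hyperTerm a m i * ((i - a) * (i + a + 1)) := by
  have h := choose_add_succ_right m i
  have h1 := choose_add_pos m i
  have h2 := choose_add_pos m (i + 1)
  have hi : (i : ℝ) + 1 ≠ 0 := by positivity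
  have h3 : (((m + (i + 1)).choose (i + 1) : ℕ) : ℝ) =
      (m + i).choose i * (m + 1 + i) / (i + 1) := by
    rw [eq_div_iff hi, h]
  have h4 : (m : ℝ) + 1 + i ≠ 0 := by positivity
  unfold hyperTerm
  rw [hyperCoeff_succ, h3]
  field_simp

theorem hyperTerm_telescope (a : ℝ) (m i : ℕ) :
    m * (m + 1) * hyperTerm a m i - (m + 1 + a) * (m - a) * hyperTerm a (m + 1) i =
      (m + 1) * (i * hyperTerm a m i - ((i + 1 : ℕ) : ℝ) * hyperTerm a m (i + 1)) := by
  have h1 := hyperTerm_succ_left a m i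
  have h2 := hyperTerm_succ_right a m i
  have h4 : (m : ℝ) + 1 + i ≠ 0 := by positivity
  apply mul_right_cancel₀ h4
  push_cast
  linear_combination (-(m + 1 + a) * (m - a)) * h1 + (m + 1) * h2

theorem exists_abs_hyperCoeff_le {a : ℝ} (ha : 0 < a) :
    ∃ C : ℝ, ∀ i : ℕ, |hyperCoeff a i| ≤ C / (i + 1) := by
  obtain ⟨N, hN⟩ := exists_nat_ge a
  set w : ℕ → ℝ := fun i => (i + 1) * |hyperCoeff a i| with hw
  have hw0 : ∀ i, 0 ≤ w i := fun i => by positivity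
  have hstep : ∀ i, N ≤ i → i * |hyperCoeff a i| ≥ ((i + 1 : ℕ) : ℝ) * |hyperCoeff a (i + 1)| := by
    intro i hi
    have hai : a ≤ i := hN.trans (Nat.cast_le.2 hi)
    have hi1 : (0 : ℝ) < i + 1 := by positivity
    have hr : 0 ≤ ((i : ℝ) - a) * ((i : ℝ) + a + 1) / ((i : ℝ) + 1) ^ 2 := by
      have := sub_nonneg.2 hai
      positivity
    rw [hyperCoeff_succ, abs_mul, abs_of_nonneg hr]
    have : ((i + 1 : ℕ) : ℝ) * (((i : ℝ) - a) * ((i : ℝ) + a + 1) / ((i : ℝ) + 1) ^ 2) ≤ i := by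
      push_cast
      rw [mul_div_assoc', div_le_iff₀ (by positivity)]
      nlinarith [mul_pos ha hi1, mul_pos (mul_pos ha hi1) ha]
    calc _ = |hyperCoeff a i| * (((i + 1 : ℕ) : ℝ) *
          (((i : ℝ) - a) * ((i : ℝ) + a + 1) / ((i : ℝ) + 1) ^ 2)) := by ring
      _ ≤ |hyperCoeff a i| * i := by gcongr
      _ = _ := by ring
  have hbound : ∀ i, i * |hyperCoeff a i| ≤ ∑ l ∈ Finset.range (N + 1), w l := by
    have hsmall : ∀ i, i ≤ N → i * |hyperCoeff a i| ≤ ∑ l ∈ Finset.range (N + 1), w l := by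
      intro i hi
      refine le_trans ?_ (Finset.single_le_sum (fun l _ => hw0 l)
        (Finset.mem_range.2 (Nat.lt_succ_of_le hi)))
      simp only [hw]
      gcongr
      linarith
    intro i
    induction i with
    | zero => exact hsmall 0 (Nat.zero_le _)
    | succ i ih =>
      rcases le_or_gt (i + 1) N with h | h
      · exact hsmall _ h
      · exact (hstep i (by omega)).trans ih
  have h0 : |hyperCoeff a 0| = 1 := by simp [hyperCoeff]
  refine ⟨2 * (∑ l ∈ Finset.range (N + 1), w l) + 1, fun i => ?_⟩
  rw [le_div_iff₀ (by positivity)]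
  have hS : 0 ≤ ∑ l ∈ Finset.range (N + 1), w l := Finset.sum_nonneg fun l _ => hw0 l
  rcases Nat.eq_zero_or_pos i with rfl | hi
  · rw [h0]; push_cast; linarith
  · have hi' : (1 : ℝ) ≤ i := by exact_mod_cast hi
    nlinarith [hbound i, abs_nonneg (hyperCoeff a i)]

theorem add_one_le_choose_add {m : ℕ} (hm : 1 ≤ m) (i : ℕ) :
    (i + 1 : ℝ) ≤ (m + i).choose i := by
  have h : (1 + i).choose i ≤ (m + i).choose i := Nat.choose_le_choose i (by omega)
  rw [add_comm 1 i, Nat.choose_succ_self_right] at h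
  exact_mod_cast h

theorem abs_hyperTerm_le {a C : ℝ} (hC : ∀ i : ℕ, |hyperCoeff a i| ≤ C / (i + 1))
    {m : ℕ} (hm : 1 ≤ m) (i : ℕ) :
    |hyperTerm a m i| ≤ C * (1 / (i + 1) ^ 2) := by
  have hc := choose_add_pos m i
  have hi : (0 : ℝ) < i + 1 := by positivity
  unfold hyperTerm
  rw [abs_div, abs_of_pos hc]
  calc |hyperCoeff a i| / ((m + i).choose i : ℝ) ≤ |hyperCoeff a i| / (i + 1) := by
        gcongr
        exact add_one_le_choose_add hm i
    _ ≤ C / (i + 1) / (i + 1) := by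
        gcongr
        exact hC i
    _ = _ := by field_simp

theorem summable_const_mul_one_div_sq (C : ℝ) :
    Summable fun i : ℕ => C * (1 / ((i : ℝ) + 1) ^ 2) := by
  have h := (summable_nat_add_iff 1).2 (Real.summable_one_div_nat_pow.2 one_lt_two)
  exact (by simpa using h : Summable fun i : ℕ => 1 / ((i : ℝ) + 1) ^ 2).mul_left C

theorem summable_hyperTerm {a : ℝ} (ha : 0 < a) {m : ℕ} (hm : 1 ≤ m) :
    Summable (hyperTerm a m) := by
  obtain ⟨C, hC⟩ := exists_abs_hyperCoeff_le ha
  exact (summable_const_mul_one_div_sq C).of_norm_bounded (abs_hyperTerm_le hC hm)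

theorem tendsto_nat_mul_hyperTerm {a : ℝ} (ha : 0 < a) {m : ℕ} (hm : 1 ≤ m) :
    Tendsto (fun i : ℕ => (i : ℝ) * hyperTerm a m i) atTop (𝓝 0) := by
  obtain ⟨C, hC⟩ := exists_abs_hyperCoeff_le ha
  have hC0 : 0 ≤ C := by simpa using (abs_nonneg _).trans (hC 0)
  refine squeeze_zero_norm (a := fun i : ℕ => C * (1 / ((i : ℝ) + 1))) (fun i => ?_) ?_
  · have hi : (0 : ℝ) < i + 1 := by positivity
    rw [norm_mul, Real.norm_natCast, Real.norm_eq_abs]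
    calc (i : ℝ) * |hyperTerm a m i| ≤ (i + 1) * (C * (1 / ((i : ℝ) + 1) ^ 2)) := by
          gcongr
          · linarith
          · exact abs_hyperTerm_le hC hm i
      _ = _ := by field_simp
  · simpa using (tendsto_one_div_add_atTop_nhds_zero_nat (𝕜 := ℝ)).const_mul C

theorem tsum_hyperTerm_succ {a : ℝ} (ha : 0 < a) {m : ℕ} (hm : 1 ≤ m) :
    m * (m + 1) * ∑' i, hyperTerm a m i =
      (m + 1 + a) * (m - a) * ∑' i, hyperTerm a (m + 1) i := by
  have h1 := ((summable_hyperTerm ha hm).hasSum.mul_left ((m : ℝ) * (m + 1))).sub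
    ((summable_hyperTerm ha (Nat.le_succ_of_le hm)).hasSum.mul_left ((m + 1 + a) * (m - a)))
  have h2 := h1.tendsto_sum_nat
  simp only [hyperTerm_telescope, ← Finset.mul_sum,
    Finset.sum_range_sub' (fun i : ℕ => (i : ℝ) * hyperTerm a m i)] at h2
  have h3 := ((tendsto_nat_mul_hyperTerm ha hm).const_sub
    (((0 : ℕ) : ℝ) * hyperTerm a m 0)).const_mul ((m : ℝ) + 1)
  have h4 := tendsto_nhds_unique h2 h3
  simp only [Nat.cast_zero, zero_mul, sub_zero, mul_zero] at h4
  linarith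

theorem tendsto_tsum_hyperTerm {a : ℝ} (ha : 0 < a) :
    Tendsto (fun m => ∑' i, hyperTerm a m i) atTop (𝓝 1) := by
  obtain ⟨C, hC⟩ := exists_abs_hyperCoeff_le ha
  have h := tendsto_tsum_of_dominated_convergence (𝓕 := atTop) (f := hyperTerm a)
    (g := fun i => if i = 0 then (1 : ℝ) else 0) (summable_const_mul_one_div_sq C) ?_ ?_
  · simpa using h
  · intro i
    rcases Nat.eq_zero_or_pos i with rfl | hi
    · simp [hyperTerm, hyperCoeff]
    · rw [if_neg hi.ne']
      refine tendsto_const_nhds.div_atTop (tendsto_atTop_mono (f := fun m : ℕ => (m : ℝ))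
        (fun m => ?_) tendsto_natCast_atTop_atTop)
      have h1 := add_one_le_choose_add hi m
      rw [← Nat.choose_symm_add, add_comm i m] at h1
      linarith
  · filter_upwards [eventually_ge_atTop 1] with m hm
    exact abs_hyperTerm_le hC hm

theorem inv_Gamma_eq_mul_inv_Gamma_add_one (s : ℝ) :
    (Real.Gamma s)⁻¹ = s * (Real.Gamma (s + 1))⁻¹ := by
  rcases eq_or_ne s 0 with rfl | hs
  · simp
  · rw [Real.Gamma_add_one hs, mul_inv, mul_inv_cancel_left₀ hs]

theorem gaussValue_succ (a : ℝ) {m : ℕ} (hm : 1 ≤ m) :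
    m * (m + 1) * gaussValue a m = (m + 1 + a) * (m - a) * gaussValue a (m + 1) := by
  have hm0 : (m : ℝ) ≠ 0 := by positivity
  have h1 := inv_Gamma_eq_mul_inv_Gamma_add_one (m + a + 1)
  have h2 := inv_Gamma_eq_mul_inv_Gamma_add_one (m - a)
  unfold gaussValue
  rw [Nat.factorial_succ, div_eq_mul_inv, div_eq_mul_inv, mul_inv, mul_inv, h1, h2]
  push_cast
  rw [Real.Gamma_add_one hm0, show (m : ℝ) + 1 + a + 1 = m + a + 1 + 1 by ring,
    show (m : ℝ) + 1 - a = m - a + 1 by ring]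
  ring

theorem Gamma_add_nat_eq_prod {s : ℝ} (hs : 0 < s) (n : ℕ) :
    Real.Gamma (s + n) = Real.Gamma s * ∏ j ∈ Finset.range n, (s + j) := by
  induction n with
  | zero => simp
  | succ n ih =>
    push_cast
    rw [← add_assoc, Real.Gamma_add_one (by positivity), ih, Finset.prod_range_succ]
    ring

theorem tendsto_Gamma_add_div_rpow {s : ℝ} (hs : 0 < s) :
    Tendsto (fun n : ℕ => Real.Gamma (s + (n + 1 : ℕ)) / ((n : ℝ) ^ s * n.factorial))
      atTop (𝓝 1) := by
  have hG := (Real.Gamma_pos_of_pos hs).ne'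
  have h := (tendsto_const_nhds (x := Real.Gamma s)).div (Real.GammaSeq_tendsto_Gamma s) hG
  rw [div_self hG] at h
  refine h.congr fun n => ?_
  rw [Pi.div_apply, Gamma_add_nat_eq_prod hs, Real.GammaSeq, div_div_eq_mul_div]

theorem tendsto_Gamma_mul_div_Gamma_mul {s t u v : ℝ} (hs : 0 < s) (ht : 0 < t) (hu : 0 < u)
    (hv : 0 < v) (h : s + t = u + v) :
    Tendsto (fun n : ℕ => Real.Gamma (s + (n + 1 : ℕ)) * Real.Gamma (t + (n + 1 : ℕ)) /
      (Real.Gamma (u + (n + 1 : ℕ)) * Real.Gamma (v + (n + 1 : ℕ)))) atTop (𝓝 1) := by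
  have hlim := ((tendsto_Gamma_add_div_rpow hs).mul (tendsto_Gamma_add_div_rpow ht)).div
    ((tendsto_Gamma_add_div_rpow hu).mul (tendsto_Gamma_add_div_rpow hv)) (by norm_num)
  rw [one_mul, div_one] at hlim
  refine hlim.congr' ?_
  filter_upwards [eventually_ge_atTop 1] with n hn
  have hn0 : (0 : ℝ) < n := by exact_mod_cast hn
  have hpow : (n : ℝ) ^ s * (n : ℝ) ^ t = (n : ℝ) ^ u * (n : ℝ) ^ v := by
    rw [← Real.rpow_add hn0, ← Real.rpow_add hn0, h]
  have hf : (n.factorial : ℝ) ≠ 0 := by positivity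
  have hD : (n : ℝ) ^ u * n.factorial * ((n : ℝ) ^ v * n.factorial) ≠ 0 := by positivity
  simp only [Pi.div_apply, div_mul_div_comm]
  rw [show (n : ℝ) ^ s * n.factorial * ((n : ℝ) ^ t * n.factorial) =
    (n : ℝ) ^ u * n.factorial * ((n : ℝ) ^ v * n.factorial) by
      linear_combination (n.factorial : ℝ) ^ 2 * hpow]
  exact div_div_div_cancel_right₀ hD _ _

theorem tendsto_gaussValue {a : ℝ} (ha : 0 < a) : Tendsto (gaussValue a) atTop (𝓝 1) := by
  obtain ⟨p, hp⟩ := exists_nat_gt a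
  have hp0 : (0 : ℝ) < p := ha.trans hp
  rw [← tendsto_add_atTop_iff_nat (p + 1)]
  refine (tendsto_Gamma_mul_div_Gamma_mul (s := p) (t := p + 1) (u := p + a + 1) (v := p - a)
    hp0 (by positivity) (by positivity) (sub_pos.2 hp) (by ring)).congr fun n => ?_
  unfold gaussValue
  rw [← Real.Gamma_nat_eq_factorial, mul_div_assoc', mul_comm (Real.Gamma _) (Real.Gamma _)]
  push_cast
  congr 3 <;> ring_nf

theorem gaussValue_pos {a : ℝ} (ha : 0 < a) {m : ℕ} (hm : a < m) : 0 < gaussValue a m := by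
  have hm0 : (0 : ℝ) < m := ha.trans hm
  have h1 := Real.Gamma_pos_of_pos hm0
  have h2 := Real.Gamma_pos_of_pos (show (0 : ℝ) < m + a + 1 by positivity)
  have h3 := Real.Gamma_pos_of_pos (sub_pos.2 hm)
  unfold gaussValue
  positivity

theorem tsum_hyperTerm_of_lt {a : ℝ} (ha : 0 < a) {m : ℕ} (hm : a < m) :
    ∑' i, hyperTerm a m i = gaussValue a m := by
  have hlt : ∀ n : ℕ, a < (m + n : ℕ) := fun n =>
    hm.trans_le (Nat.cast_le.2 (Nat.le_add_right m n))
  have hconst : ∀ n : ℕ, (∑' i, hyperTerm a (m + n) i) / gaussValue a (m + n) =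
      (∑' i, hyperTerm a m i) / gaussValue a m := by
    intro n
    induction n with
    | zero => rfl
    | succ n ih =>
      have hpos : (0 : ℝ) < (m + n : ℕ) := ha.trans (hlt n)
      have h1 : 1 ≤ m + n := by exact_mod_cast hpos
      have hF := tsum_hyperTerm_succ ha h1
      have hG := gaussValue_succ a h1
      have hc : ((m + n : ℕ) + 1 + a) * (((m + n : ℕ) : ℝ) - a) ≠ 0 :=
        mul_ne_zero (by positivity) (sub_pos.2 (hlt n)).ne'
      have hd : ((m + n : ℕ) : ℝ) * ((m + n : ℕ) + 1) ≠ 0 := by positivity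
      rw [← ih, ← mul_div_mul_left _ (gaussValue a (m + n)) hd, hF, hG, mul_div_mul_left _ _ hc,
        add_assoc]
  have hlim := ((tendsto_tsum_hyperTerm ha).div (tendsto_gaussValue ha) one_ne_zero).comp
    (tendsto_add_atTop_nat m)
  have hlim' : Tendsto (fun _ : ℕ => (∑' i, hyperTerm a m i) / gaussValue a m) atTop
      (𝓝 (1 / 1)) := by
    refine hlim.congr fun n => ?_
    simpa [add_comm] using hconst n
  have h := tendsto_nhds_unique tendsto_const_nhds hlim'
  rwa [div_one, div_eq_one_iff_eq (gaussValue_pos ha hm).ne'] at h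

/-- Gauss's summation theorem for `₂F₁(-a, a+1; m+1; 1)`. -/
theorem hasSum_hyperTerm {a : ℝ} (ha : 0 < a) {m : ℕ} (hm : 1 ≤ m) :
    HasSum (hyperTerm a m) (gaussValue a m) := by
  obtain ⟨p, hp⟩ := exists_nat_gt a
  suffices h : ∀ n m : ℕ, 1 ≤ m → p ≤ m + n → ∑' i, hyperTerm a m i = gaussValue a m by
    rw [← h p m hm (Nat.le_add_left p m)]
    exact (summable_hyperTerm ha hm).hasSum
  intro n
  induction n with
  | zero => exact fun m _ h => tsum_hyperTerm_of_lt ha (hp.trans_le (Nat.cast_le.2 h))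
  | succ n ih =>
    intro m hm h
    have hd : (m : ℝ) * (m + 1) ≠ 0 := by positivity
    apply mul_left_cancel₀ hd
    rw [tsum_hyperTerm_succ ha hm, gaussValue_succ a hm, ih (m + 1) (by omega) (by omega)]

theorem gbinom_mul_poch_eq_hyperCoeff (a : ℝ) (i : ℕ) :
    (-1) ^ i * gbinom a i * poch (a + 1) i = i.factorial * hyperCoeff a i := by
  have h : (-1) ^ i * (∏ l ∈ Finset.range i, (a - (l : ℝ))) * poch (a + 1) i =
      (i.factorial : ℝ) ^ 2 * hyperCoeff a i := by
    induction i with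
    | zero => simp [poch, hyperCoeff]
    | succ i ih =>
      have hi : (i : ℝ) + 1 ≠ 0 := by positivity
      have hp : poch (a + 1) (i + 1) = poch (a + 1) i * (a + 1 + i) :=
        Finset.prod_range_succ _ _
      rw [hp, hyperCoeff_succ, Finset.prod_range_succ, Nat.factorial_succ]
      push_cast
      field_simp
      linear_combination (i - a) * (a + 1 + i) * ih
  have hf : (i.factorial : ℝ) ≠ 0 := by positivity
  rw [gbinom, if_pos (Int.natCast_nonneg i), Int.toNat_natCast]
  field_simp
  linear_combination h

/-- `∑_{i=j}^∞ ((-1)^i/(i-k)!) C(α+2, i-j) (α+3)_{i-j}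
  = (-1)^j Γ(j-k) / (Γ(j-k+α+3) Γ(j-k-α-2))` for integers `j > k ≥ 1`
(the summation index is shifted by `j`). -/
theorem statement8 (α : ℝ) (hα : -1 < α) (j k : ℕ) (hk : 1 ≤ k) (hjk : k < j) :
    HasSum
      (fun i : ℕ => (-1 : ℝ) ^ (i + j) / (Nat.factorial (i + j - k) : ℝ) *
        gbinom (α + 2) (i : ℤ) * poch (α + 3) i)
      ((-1 : ℝ) ^ j * Real.Gamma ((j : ℝ) - (k : ℝ)) /
        (Real.Gamma ((j : ℝ) - (k : ℝ) + α + 3) * Real.Gamma ((j : ℝ) - (k : ℝ) - α - 2))) := by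
  obtain ⟨m, rfl⟩ := Nat.exists_eq_add_of_lt hjk
  have hsum := (hasSum_hyperTerm (a := α + 2) (by linarith) (Nat.le_add_left 1 m)).mul_left
    ((-1 : ℝ) ^ (k + m + 1) / ((m + 1).factorial : ℝ))
  have hf : ((m + 1).factorial : ℝ) ≠ 0 := by positivity
  convert! hsum using 1
  · funext i
    have h := gbinom_mul_poch_eq_hyperCoeff (α + 2) i
    rw [show α + 2 + 1 = α + 3 by ring] at h
    have hc := congrArg (Nat.cast : ℕ → ℝ) (Nat.add_choose_mul_factorial_mul_factorial (m + 1) i)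
    have hch := choose_add_pos (m + 1) i
    push_cast at hc
    have hidx : i + (k + m + 1) - k = m + 1 + i := by omega
    have hi : (i.factorial : ℝ) ≠ 0 := by positivity
    rw [hidx, ← hc, hyperTerm, pow_add]
    field_simp
    linear_combination h
  · unfold gaussValue
    push_cast
    rw [show (k : ℝ) + m + 1 - k = m + 1 by ring,
      show (m : ℝ) + 1 + α + 3 = m + 1 + (α + 2) + 1 by ring,
      show (m : ℝ) + 1 - α - 2 = m + 1 - (α + 2) by ring]
    field_simp
end

section
/- For every real α > −1, all real M, N, every integer n ≥ 1 and every real x, the Sobolev-type generalized Laguerre polynomial y = L_n^{α,M,N} satisfies the infinite order differential equation Σ_{i=0}^∞ b_i^*(α,x)·y^{(i)}(x) + M·Σ_{i=0}^∞ c_i^*(x)·y^{(i)}(x) = 0; both sums have only finitely many nonzero terms since y is a polynomial. -/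
open Finset

/-- The coefficient functions `b_i^*(α, x) = (1/i!) ∑_{j=0}^i (-1)^j C(i,j) (α+1)_{i-j} x^j`. -/
noncomputable def bStar (α : ℝ) (i : ℕ) (x : ℝ) : ℝ :=
  (1 / (Nat.factorial i : ℝ)) * ∑ j ∈ Finset.range (i + 1),
    (-1 : ℝ) ^ j * (Nat.choose i j : ℝ) * poch (α + 1) (i - j) * x ^ j

/-- The coefficient functions `c_i^*(x) = (-1)^i x^i / i!`. -/
noncomputable def cStar (i : ℕ) (x : ℝ) : ℝ :=
  (-1 : ℝ) ^ i * x ^ i / (Nat.factorial i : ℝ)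

/-- The Sobolev-type generalized Laguerre polynomial
`L_n^{α,M,N}(x) = A₀ L_n^α(x) + A₁ (L_n^α)'(x) + A₂ (L_n^α)''(x)`. -/
noncomputable def sobolevLaguerre (α M N : ℝ) (n : ℕ) (x : ℝ) : ℝ :=
  (1 + M * gbinom ((n : ℝ) + α) ((n : ℤ) - 1)
      + (((n : ℝ) * (α + 2) - (α + 1)) / ((α + 1) * (α + 3))) * N *
          gbinom ((n : ℝ) + α) ((n : ℤ) - 2)
      + (M * N / ((α + 1) * (α + 2))) * gbinom ((n : ℝ) + α) ((n : ℤ) - 1) *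
          gbinom ((n : ℝ) + α + 1) ((n : ℤ) - 2)) * laguerre α n x
    + (M * gbinom ((n : ℝ) + α) (n : ℤ)
      + (((n : ℝ) - 1) / (α + 1)) * N * gbinom ((n : ℝ) + α) ((n : ℤ) - 1)
      + (2 * M * N / (α + 1) ^ 2) * gbinom ((n : ℝ) + α) (n : ℤ) *
          gbinom ((n : ℝ) + α + 1) ((n : ℤ) - 2)) * deriv (laguerre α n) x
    + ((N / (α + 1)) * gbinom ((n : ℝ) + α) ((n : ℤ) - 1)
      + (M * N / (α + 1) ^ 2) * gbinom ((n : ℝ) + α) (n : ℤ) *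
          gbinom ((n : ℝ) + α + 1) ((n : ℤ) - 1)) * iteratedDeriv 2 (laguerre α n) x

open Polynomial in
/-- Taylor expansion at `x`, evaluated at the origin. -/
lemma sum_neg_pow_mul_eval_iterate_derivative (R : ℝ[X]) {m : ℕ} (h : R.natDegree < m) (x : ℝ) :
    ∑ j ∈ range m, (-x) ^ j / (j.factorial : ℝ) * (derivative^[j] R).eval x = R.eval 0 := by
  have key : (taylor x R).eval (-x) = R.eval 0 := by
    rw [taylor_eval]; simp
  rw [← key, eval_eq_sum_range' (n := m) (by rwa [natDegree_taylor])]
  refine sum_congr rfl fun j _ => ?_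
  rw [taylor_coeff, ← factorial_smul_hasseDeriv]
  have : (j.factorial : ℝ) ≠ 0 := by positivity
  rw [LinearMap.smul_apply, nsmul_eq_mul, eval_mul, eval_natCast]
  field_simp

open Polynomial in
lemma iteratedDeriv_eval (Q : ℝ[X]) (i : ℕ) (x : ℝ) :
    iteratedDeriv i (fun t => Q.eval t) x = (derivative^[i] Q).eval x := by
  induction i generalizing Q with
  | zero => simp
  | succ i ih =>
    rw [iteratedDeriv_succ']
    have : deriv (fun t => Q.eval t) = fun t => (derivative Q).eval t := by
      ext t; exact Q.deriv
    rw [this, ih, Function.iterate_succ_apply]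

open Polynomial in
lemma tsum_mul_iteratedDeriv_eval (f : ℕ → ℝ) (Q : ℝ[X]) {m : ℕ} (h : Q.natDegree < m) (x : ℝ) :
    ∑' i, f i * iteratedDeriv i (fun t => Q.eval t) x
      = ∑ i ∈ range m, f i * (derivative^[i] Q).eval x := by
  rw [tsum_eq_sum (s := range m)]
  · simp only [iteratedDeriv_eval]
  · intro i hi
    rw [mem_range, not_lt] at hi
    rw [iteratedDeriv_eval, iterate_derivative_eq_zero (by omega)]
    simp

open Polynomial in
lemma tsum_cStar_mul (Q : ℝ[X]) (x : ℝ) :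
    ∑' i, cStar i x * iteratedDeriv i (fun t => Q.eval t) x = Q.eval 0 := by
  rw [tsum_mul_iteratedDeriv_eval _ Q (Nat.lt_succ_self _),
    ← sum_neg_pow_mul_eval_iterate_derivative Q (Nat.lt_succ_self _) x]
  refine sum_congr rfl fun i _ => ?_
  rw [cStar, neg_pow x]

open Polynomial in
/-- The functional `p ↦ (1 / Γ(α + 1)) ∫ p(t) t^α e^{-t} dt` over `(0, ∞)`, given by its moments
`(α + 1)_k` on polynomials of degree less than `m`. -/
noncomputable def laguerreMoment (α : ℝ) (m : ℕ) : ℝ[X] →ₗ[ℝ] ℝ :=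
  ∑ k ∈ range m, poch (α + 1) k • lcoeff ℝ k

open Polynomial in
lemma laguerreMoment_apply (α : ℝ) (m : ℕ) (Q : ℝ[X]) :
    laguerreMoment α m Q = ∑ k ∈ range m, poch (α + 1) k * Q.coeff k := by
  simp [laguerreMoment]

lemma bStar_eq_sum (α : ℝ) (i : ℕ) (x : ℝ) :
    bStar α i x = ∑ k ∈ range (i + 1),
      poch (α + 1) k / (k.factorial : ℝ) * ((-x) ^ (i - k) / ((i - k).factorial : ℝ)) := by
  rw [bStar, mul_sum, ← sum_range_reflect]
  refine sum_congr rfl fun k hk => ?_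
  have hk' : k ≤ i := Nat.lt_succ_iff.mp (mem_range.mp hk)
  have e : i + 1 - 1 - k = i - k := by omega
  have e' : i - (i - k) = k := by omega
  rw [e, e', Nat.choose_symm hk', Nat.cast_choose ℝ hk', neg_pow x]
  have h1 : (i.factorial : ℝ) ≠ 0 := by positivity
  have h2 : (k.factorial : ℝ) ≠ 0 := by positivity
  have h3 : ((i - k).factorial : ℝ) ≠ 0 := by positivity
  field_simp

open Polynomial in
lemma tsum_bStar_mul (α : ℝ) (Q : ℝ[X]) {m : ℕ} (h : Q.natDegree < m) (x : ℝ) :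
    ∑' i, bStar α i x * iteratedDeriv i (fun t => Q.eval t) x = laguerreMoment α m Q := by
  rw [tsum_mul_iteratedDeriv_eval _ Q h, laguerreMoment_apply]
  obtain ⟨f, hf⟩ : ∃ f : ℕ → ℕ → ℝ, ∀ k j, f k j = poch (α + 1) k / (k.factorial : ℝ) *
      ((-x) ^ j / (j.factorial : ℝ) * (derivative^[j] (derivative^[k] Q)).eval x) :=
    ⟨_, fun _ _ => rfl⟩
  have e : ∀ i ∈ range m, bStar α i x * (derivative^[i] Q).eval x =
      ∑ k ∈ range (i + 1), f k (i - k) := by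
    intro i _
    rw [bStar_eq_sum, sum_mul]
    refine sum_congr rfl fun k hk => ?_
    have hk' : i - k + k = i := Nat.sub_add_cancel (Nat.lt_succ_iff.mp (mem_range.mp hk))
    simp only [hf, ← Function.iterate_add_apply, hk', mul_assoc]
  rw [sum_congr rfl e, sum_range_diag_flip]
  refine sum_congr rfl fun k hk => ?_
  have hk' := mem_range.mp hk
  have hd := natDegree_iterate_derivative Q k
  simp only [hf]
  rw [← mul_sum, sum_neg_pow_mul_eval_iterate_derivative _ (by omega), ← coeff_zero_eq_eval_zero,
    coeff_iterate_derivative, zero_add, Nat.descFactorial_self, nsmul_eq_mul]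
  have : (k.factorial : ℝ) ≠ 0 := by positivity
  field_simp

lemma gbinom_natCast_s12 (z : ℝ) (k : ℕ) :
    gbinom z (k : ℤ) = (∏ j ∈ range k, (z - (j : ℝ))) / (k.factorial : ℝ) := by
  simp [gbinom]

lemma gbinom_of_neg (z : ℝ) {k : ℤ} (hk : k < 0) : gbinom z k = 0 := by
  simp [gbinom, hk]

lemma gbinom_add_one_mul (z : ℝ) (k : ℤ) :
    gbinom z (k + 1) * ((k : ℝ) + 1) = gbinom z k * (z - k) := by
  rcases lt_or_ge k 0 with hk | hk
  · rw [gbinom_of_neg z hk]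
    rcases (show k = -1 ∨ k + 1 < 0 by omega) with rfl | h
    · simp
    · simp [gbinom_of_neg z h]
  · lift k to ℕ using hk
    have : (k.factorial : ℝ) ≠ 0 := by positivity
    have : (k : ℝ) + 1 ≠ 0 := by positivity
    rw [show (k : ℤ) + 1 = ((k + 1 : ℕ) : ℤ) by push_cast; rfl, gbinom_natCast_s12, gbinom_natCast_s12,
      prod_range_succ, Nat.factorial_succ]
    push_cast
    field_simp

/-- Pascal's rule. -/
lemma gbinom_add_one_add_one (z : ℝ) (k : ℤ) :
    gbinom (z + 1) (k + 1) = gbinom z k + gbinom z (k + 1) := by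
  rcases lt_or_ge k 0 with hk | hk
  · rw [gbinom_of_neg z hk]
    rcases (show k = -1 ∨ k + 1 < 0 by omega) with rfl | h
    · simp [gbinom]
    · simp [gbinom_of_neg _ h]
  · lift k to ℕ using hk
    have : (k.factorial : ℝ) ≠ 0 := by positivity
    have : (k : ℝ) + 1 ≠ 0 := by positivity
    rw [show (k : ℤ) + 1 = ((k + 1 : ℕ) : ℤ) by push_cast; rfl, gbinom_natCast_s12, gbinom_natCast_s12,
      gbinom_natCast_s12, prod_range_succ', prod_range_succ, Nat.factorial_succ]
    have e : ∀ j ∈ range k, z + 1 - ((j + 1 : ℕ) : ℝ) = z - j := by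
      intro j _; push_cast; ring
    rw [prod_congr rfl e]
    push_cast
    field_simp
    ring

open Polynomial in
/-- The Laguerre polynomial `L_n^α` as an element of `ℝ[X]`. -/
noncomputable def laguerrePoly (α : ℝ) (n : ℕ) : ℝ[X] :=
  ∑ k ∈ range (n + 1),
    monomial k ((-1 : ℝ) ^ k * gbinom ((n : ℝ) + α) ((n : ℤ) - (k : ℤ)) / (k.factorial : ℝ))

open Polynomial in
lemma laguerre_eq_eval (α : ℝ) (n : ℕ) :
    laguerre α n = fun x => (laguerrePoly α n).eval x := by
  ext x
  simp only [laguerre, laguerrePoly, eval_finsetSum, eval_monomial]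
  exact sum_congr rfl fun k _ => by ring

open Polynomial in
lemma coeff_laguerrePoly (α : ℝ) (n k : ℕ) : (laguerrePoly α n).coeff k =
    (-1 : ℝ) ^ k * gbinom ((n : ℝ) + α) ((n : ℤ) - (k : ℤ)) / (k.factorial : ℝ) := by
  simp only [laguerrePoly, finsetSum_coeff, coeff_monomial, sum_ite_eq', mem_range]
  split_ifs with h
  · rfl
  · rw [gbinom_of_neg _ (by omega)]; simp

open Polynomial in
lemma natDegree_laguerrePoly_le (α : ℝ) (n : ℕ) : (laguerrePoly α n).natDegree ≤ n := by
  rw [natDegree_le_iff_coeff_eq_zero]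
  intro k hk
  rw [coeff_laguerrePoly, gbinom_of_neg _ (by omega)]
  simp

open Polynomial in
lemma derivative_laguerrePoly_succ (α : ℝ) (n : ℕ) :
    derivative (laguerrePoly α (n + 1)) = derivative (laguerrePoly α n) - laguerrePoly α n := by
  ext k
  rw [coeff_sub, coeff_derivative, coeff_derivative, coeff_laguerrePoly, coeff_laguerrePoly,
    coeff_laguerrePoly, Nat.factorial_succ]
  have h := gbinom_add_one_add_one ((n : ℝ) + α) ((n : ℤ) - k - 1)
  rw [show (n : ℤ) - k - 1 + 1 = n - k by ring] at h
  rw [show ((n + 1 : ℕ) : ℤ) - ((k + 1 : ℕ) : ℤ) = n - k by push_cast; ring,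
    show (n : ℤ) - ((k + 1 : ℕ) : ℤ) = n - k - 1 by push_cast; ring,
    show ((n + 1 : ℕ) : ℝ) + α = n + α + 1 by push_cast; ring, h]
  have : (k.factorial : ℝ) ≠ 0 := by positivity
  have : (k : ℝ) + 1 ≠ 0 := by positivity
  push_cast
  field_simp
  ring

lemma poch_mul_gbinom (α : ℝ) (k d : ℕ) :
    poch (α + 1) k * gbinom (((k + d : ℕ) : ℝ) + α) (d : ℤ)
      = poch (α + 1) (k + d) / (d.factorial : ℝ) := by
  rw [gbinom_natCast_s12, poch, poch, prod_range_add, ← prod_range_reflect (fun j : ℕ =>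
    (((k + d : ℕ) : ℝ) + α - (j : ℝ))), mul_div_assoc]
  congr 2
  refine prod_congr rfl fun j hj => ?_
  have hj' := mem_range.mp hj
  rw [Nat.sub_sub, Nat.cast_sub (by omega)]
  push_cast
  ring

lemma laguerreMoment_laguerrePoly {m n : ℕ} (α : ℝ) (hn : n ≠ 0) (hm : n < m) :
    laguerreMoment α m (laguerrePoly α n) = 0 := by
  have hs := sum_subset (range_mono (Nat.succ_le_of_lt hm))
    (f := fun k => poch (α + 1) k * (laguerrePoly α n).coeff k) (by
      intro k _ hk
      rw [mem_range, not_lt] at hk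
      rw [Polynomial.coeff_eq_zero_of_natDegree_lt
        ((natDegree_laguerrePoly_le α n).trans_lt hk), mul_zero])
  have halt : ∑ k ∈ range (n + 1), (-1 : ℝ) ^ k * (n.choose k : ℝ) = 0 := by
    exact_mod_cast Int.alternating_sum_range_choose_of_ne hn
  rw [laguerreMoment_apply, ← hs]
  calc ∑ k ∈ range (n + 1), poch (α + 1) k * (laguerrePoly α n).coeff k
      = ∑ k ∈ range (n + 1), poch (α + 1) n / (n.factorial : ℝ) *
          ((-1 : ℝ) ^ k * (n.choose k : ℝ)) := by
        refine sum_congr rfl fun k hk => ?_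
        obtain ⟨d, rfl⟩ := Nat.exists_eq_add_of_le (Nat.lt_succ_iff.mp (mem_range.mp hk))
        have h := poch_mul_gbinom α k d
        rw [coeff_laguerrePoly, Nat.cast_add_choose,
          show ((k + d : ℕ) : ℤ) - k = d by push_cast; ring]
        have h1 : (k.factorial : ℝ) ≠ 0 := by positivity
        have h2 : (d.factorial : ℝ) ≠ 0 := by positivity
        have h3 : ((k + d).factorial : ℝ) ≠ 0 := by positivity
        rw [eq_div_iff h2] at h
        field_simp
        linear_combination h
    _ = 0 := by rw [← mul_sum, halt, mul_zero]

open Polynomial in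
lemma laguerrePoly_zero (α : ℝ) : laguerrePoly α 0 = 1 := by
  simp [laguerrePoly, gbinom]

lemma laguerreMoment_one (α : ℝ) {m : ℕ} (hm : 0 < m) : laguerreMoment α m 1 = 1 := by
  rw [laguerreMoment_apply, sum_eq_single_of_mem 0 (mem_range.mpr hm)]
  · simp [poch]
  · intro k _ hk
    simp [Polynomial.coeff_one, hk]

open Polynomial in
lemma laguerreMoment_derivative_laguerrePoly (α : ℝ) {m : ℕ} (n : ℕ) (hm : n + 1 < m) :
    laguerreMoment α m (derivative (laguerrePoly α (n + 1))) = -1 := by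
  induction n with
  | zero =>
    rw [derivative_laguerrePoly_succ, laguerrePoly_zero, map_sub,
      laguerreMoment_one α (by omega)]
    simp
  | succ n ih =>
    rw [derivative_laguerrePoly_succ, map_sub, ih (by omega),
      laguerreMoment_laguerrePoly α (by omega) (by omega), sub_zero]

open Polynomial in
lemma laguerreMoment_derivative_derivative_laguerrePoly (α : ℝ) {m : ℕ} (n : ℕ) (hm : n + 1 < m) :
    laguerreMoment α m (derivative (derivative (laguerrePoly α (n + 1)))) = n := by
  induction n with
  | zero =>
    rw [derivative_laguerrePoly_succ, laguerrePoly_zero]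
    simp
  | succ n ih =>
    rw [derivative_laguerrePoly_succ, derivative_sub, map_sub, ih (by omega),
      laguerreMoment_derivative_laguerrePoly α n (by omega)]
    push_cast
    ring

open Polynomial in
lemma eval_zero_laguerrePoly (α : ℝ) (n : ℕ) :
    (laguerrePoly α n).eval 0 = gbinom ((n : ℝ) + α) (n : ℤ) := by
  rw [← coeff_zero_eq_eval_zero, coeff_laguerrePoly]
  simp

open Polynomial in
lemma eval_zero_derivative_laguerrePoly (α : ℝ) (n : ℕ) :
    (derivative (laguerrePoly α n)).eval 0 = -gbinom ((n : ℝ) + α) ((n : ℤ) - 1) := by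
  rw [← coeff_zero_eq_eval_zero, coeff_derivative, coeff_laguerrePoly]
  simp

open Polynomial in
lemma eval_zero_derivative_derivative_laguerrePoly (α : ℝ) (n : ℕ) :
    (derivative (derivative (laguerrePoly α n))).eval 0 =
      gbinom ((n : ℝ) + α) ((n : ℤ) - 2) := by
  rw [← coeff_zero_eq_eval_zero, coeff_derivative, coeff_derivative, coeff_laguerrePoly]
  norm_num

open Polynomial in
/-- For a combination `y = a₀ L_n^α + a₁ (L_n^α)' + a₂ (L_n^α)''`, the infinite order expression is
constant in `x` and explicit. -/
lemma tsum_bStar_add_tsum_cStar (α M a₀ a₁ a₂ : ℝ) {n : ℕ} (hn : 1 ≤ n) (x : ℝ) {y : ℝ → ℝ}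
    (hy : ∀ t, y t = a₀ * laguerre α n t + a₁ * deriv (laguerre α n) t
      + a₂ * iteratedDeriv 2 (laguerre α n) t) :
    ∑' i : ℕ, bStar α i x * iteratedDeriv i y x + M * ∑' i : ℕ, cStar i x * iteratedDeriv i y x
      = -a₁ + (n - 1) * a₂ + M * (a₀ * gbinom ((n : ℝ) + α) (n : ℤ)
        - a₁ * gbinom ((n : ℝ) + α) ((n : ℤ) - 1)
        + a₂ * gbinom ((n : ℝ) + α) ((n : ℤ) - 2)) := by
  set P := laguerrePoly α n with hP
  set Q : ℝ[X] := a₀ • P + a₁ • derivative P + a₂ • derivative (derivative P) with hQ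
  have hyQ : y = fun t => Q.eval t := by
    ext t
    rw [hy t, laguerre_eq_eval, iteratedDeriv_eval, Polynomial.deriv]
    simp [hQ, hP]
  have hm₁ : Q.natDegree < max (Q.natDegree + 1) (n + 1) := by omega
  have hm₂ : n < max (Q.natDegree + 1) (n + 1) := by omega
  rw [hyQ, tsum_cStar_mul, tsum_bStar_mul α Q hm₁]
  generalize max (Q.natDegree + 1) (n + 1) = m at hm₂
  obtain ⟨k, rfl⟩ := Nat.exists_eq_add_of_le' hn
  simp only [hQ, map_add, map_smul, eval_add, eval_smul, smul_eq_mul, hP,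
    laguerreMoment_laguerrePoly α k.succ_ne_zero hm₂,
    laguerreMoment_derivative_laguerrePoly α k hm₂,
    laguerreMoment_derivative_derivative_laguerrePoly α k hm₂,
    eval_zero_laguerrePoly, eval_zero_derivative_laguerrePoly,
    eval_zero_derivative_derivative_laguerrePoly]
  push_cast
  ring

/-- The infinite order differential equation
`∑_{i=0}^∞ b_i^*(α,x) y^{(i)}(x) + M ∑_{i=0}^∞ c_i^*(x) y^{(i)}(x) = 0`
for `y = L_n^{α,M,N}`, `n ≥ 1`. -/
theorem statement12 (α : ℝ) (hα : -1 < α) (M N : ℝ) (n : ℕ) (hn : 1 ≤ n) (x : ℝ) :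
    ∑' i : ℕ, bStar α i x * iteratedDeriv i (sobolevLaguerre α M N n) x
      + M * ∑' i : ℕ, cStar i x * iteratedDeriv i (sobolevLaguerre α M N n) x = 0 := by
  refine (tsum_bStar_add_tsum_cStar α M _ _ _ hn x
    (y := sobolevLaguerre α M N n) fun t => rfl).trans ?_
  have hn0 : (n : ℝ) ≠ 0 := by positivity
  have h1 : α + 1 ≠ 0 := by linarith
  have h2 : α + 2 ≠ 0 := by linarith
  have h3 : α + 3 ≠ 0 := by linarith
  have e0 := gbinom_add_one_mul ((n : ℝ) + α) ((n : ℤ) - 1)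
  have e1 := gbinom_add_one_mul ((n : ℝ) + α) ((n : ℤ) - 2)
  have e2 := gbinom_add_one_mul ((n : ℝ) + α + 1) ((n : ℤ) - 2)
  have e3 := gbinom_add_one_add_one ((n : ℝ) + α) ((n : ℤ) - 2)
  rw [show (n : ℤ) - 2 + 1 = n - 1 by ring] at e1 e2 e3
  rw [show (n : ℤ) - 1 + 1 = n by ring] at e0
  push_cast at e0 e1 e2
  generalize gbinom ((n : ℝ) + α) (n : ℤ) = c₀ at *
  generalize gbinom ((n : ℝ) + α) ((n : ℤ) - 1) = c₁ at *
  generalize gbinom ((n : ℝ) + α) ((n : ℤ) - 2) = c₂ at *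
  generalize gbinom ((n : ℝ) + α + 1) ((n : ℤ) - 1) = d₁ at *
  generalize gbinom ((n : ℝ) + α + 1) ((n : ℤ) - 2) = d₂ at *
  obtain rfl : c₀ = c₁ * (α + 1) / n := by
    rw [eq_div_iff hn0]; linear_combination e0
  obtain rfl : c₂ = c₁ * (n - 1) / (α + 2) := by
    rw [eq_div_iff h2]; linear_combination -e1
  obtain rfl : d₂ = d₁ * (n - 1) / (α + 3) := by
    rw [eq_div_iff h3]; linear_combination -e2
  subst e3
  field_simp
  ring
end
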